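/- arXiv:2409.04024 — 2 statements merged into one kernel-verified Lean document; each statement's English description precedes it below -/
import Mathlib

section
/- Let δ > 0 and a2 < 0, and take a1 = −1 in system (II), so that system (II) reads x' = y, y' = −x(x² − 1)² − δ(a2 + x²)·y. Then any two nonconstant periodic solutions of this system have the same image (range) in ℝ × ℝ. (That is, the system has at most one limit cycle.) -/
/-- A solution of system (II) with a1 = −1: x' = y, y' = −x(x² − 1)² − δ(a2 + x²) y. -/
def IsSolIIm1 (a2 δ : ℝ) (γ : ℝ → ℝ × ℝ) : Prop :=
  ∀ t : ℝ, HasDerivAt γ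
    ((γ t).2,
      -((γ t).1 * ((γ t).1 ^ 2 - 1) ^ 2) - δ * (a2 + (γ t).1 ^ 2) * (γ t).2) t

/-- A nonconstant periodic solution of that system. -/
def IsNonconstPeriodicSolIIm1 (a2 δ : ℝ) (γ : ℝ → ℝ × ℝ) : Prop :=
  IsSolIIm1 a2 δ γ ∧ (∃ T : ℝ, 0 < T ∧ ∀ t : ℝ, γ (t + T) = γ t) ∧
    ¬ (∀ t s : ℝ, γ t = γ s)

open Set

/-- A solution of a scalar linear homogeneous equation with bounded coefficient that is positive
at the right end of an interval is positive on the whole interval. -/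
lemma pos_of_hasDerivAt_mul_self {v c : ℝ → ℝ} {a b M : ℝ}
    (hv : ContinuousOn v (Icc a b)) (hd : ∀ x ∈ Ioo a b, HasDerivAt v (c x * v x) x)
    (hc : ∀ x ∈ Ioo a b, c x ≤ M) (hb : 0 < v b) {x : ℝ} (hx : x ∈ Icc a b) : 0 < v x := by
  have hanti : AntitoneOn (fun x ↦ v x ^ 2 * Real.exp (-(2 * M * x))) (Icc a b) := by
    refine antitoneOn_of_hasDerivWithinAt_nonpos (convex_Icc a b)
      (f' := fun x ↦ 2 * (c x - M) * (v x ^ 2 * Real.exp (-(2 * M * x)))) ?_ ?_ ?_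
    · exact (hv.pow 2).mul (by fun_prop)
    · intro t ht
      rw [interior_Icc] at ht
      have h1 : HasDerivAt (fun x ↦ Real.exp (-(2 * M * x)))
          (Real.exp (-(2 * M * t)) * (-(2 * M * 1))) t :=
        (((hasDerivAt_id t).const_mul (2 * M)).neg).exp
      refine ((((hd t ht).pow 2).mul h1).congr_deriv ?_).hasDerivWithinAt
      simp only [Pi.pow_apply]
      push_cast
      ring
    · intro t ht
      rw [interior_Icc] at ht
      have h1 := hc t ht
      exact mul_nonpos_of_nonpos_of_nonneg (by linarith) (by positivity)
  have hne : ∀ t ∈ Icc a b, v t ≠ 0 := by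
    intro t ht h0
    have h1 := hanti ht (right_mem_Icc.2 (ht.1.trans ht.2)) ht.2
    simp only [h0] at h1
    have h2 : 0 < v b ^ 2 * Real.exp (-(2 * M * b)) := by positivity
    norm_num at h1
    linarith
  by_contra! h
  obtain ⟨t, ht, h0⟩ := intermediate_value_Icc hx.2 (hv.mono (Icc_subset_Icc_left hx.1))
    ⟨h, hb.le⟩
  exact hne t ⟨hx.1.trans ht.1, ht.2⟩ h0

/-- The graph `y = -w x`, `0 ≤ x ≤ α`, is an arc of an orbit of system (II) joining the point
`(α, 0)` to the `y`-axis. -/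
structure IsBranch (a δ α : ℝ) (w : ℝ → ℝ) : Prop where
  pos_right : 0 < α
  continuousOn : ContinuousOn w (Icc 0 α)
  pos : ∀ x ∈ Ico 0 α, 0 < w x
  eq_zero : w α = 0
  hasDerivAt : ∀ x ∈ Ioo 0 α, HasDerivAt w (δ * (a + x ^ 2) - x * (x ^ 2 - 1) ^ 2 / w x) x

namespace IsBranch

variable {a δ α α₁ α₂ : ℝ} {w u l u₁ l₁ u₂ l₂ w₁ w₂ : ℝ → ℝ}

lemma nonneg (h : IsBranch a δ α w) {x : ℝ} (hx : x ∈ Icc 0 α) : 0 ≤ w x := by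
  rcases hx.2.eq_or_lt with rfl | h1
  · exact h.eq_zero.ge
  · exact (h.pos x ⟨hx.1, h1⟩).le

lemma lt (h₁ : IsBranch a δ α₁ w₁) (h₂ : IsBranch a δ α₂ w₂) (hα : α₁ < α₂)
    {x : ℝ} (hx : x ∈ Icc 0 α₁) : w₁ x < w₂ x := by
  have hsub : Icc 0 α₁ ⊆ Ico 0 α₂ := fun t ht ↦ ⟨ht.1, ht.2.trans_lt hα⟩
  have hc₂ : ContinuousOn w₂ (Icc 0 α₁) := h₂.continuousOn.mono (Icc_subset_Icc_right hα.le)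
  have hpos : ∀ t ∈ Icc 0 α₁, 0 < w₂ t + w₁ t := fun t ht ↦
    add_pos_of_pos_of_nonneg (h₂.pos t (hsub ht)) (h₁.nonneg ht)
  have hcoef : ContinuousOn (fun t ↦ 2 * δ * (a + t ^ 2) / (w₂ t + w₁ t)) (Icc 0 α₁) :=
    ContinuousOn.div (by fun_prop) (hc₂.add h₁.continuousOn) fun t ht ↦ (hpos t ht).ne'
  obtain ⟨M, hM⟩ := isCompact_Icc.bddAbove_image hcoef
  have key : 0 < w₂ x ^ 2 - w₁ x ^ 2 := by
    refine pos_of_hasDerivAt_mul_self (v := fun t ↦ w₂ t ^ 2 - w₁ t ^ 2)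
      (c := fun t ↦ 2 * δ * (a + t ^ 2) / (w₂ t + w₁ t)) (M := M)
      ((hc₂.pow 2).sub (h₁.continuousOn.pow 2)) ?_ ?_ ?_ hx
    · intro t ht
      have p₁ := h₁.pos t ⟨ht.1.le, ht.2⟩
      have p₂ := h₂.pos t (hsub ⟨ht.1.le, ht.2.le⟩)
      refine (((h₂.hasDerivAt t ⟨ht.1, ht.2.trans hα⟩).pow 2).sub
        ((h₁.hasDerivAt t ht).pow 2)).congr_deriv ?_
      field_simp
      ring
    · exact fun t ht ↦ hM (mem_image_of_mem _ (Ioo_subset_Icc_self ht))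
    · simpa [h₁.eq_zero] using pow_pos (h₂.pos α₁ (hsub (right_mem_Icc.2 h₁.pos_right.le))) 2
  have p₂ := h₂.pos x (hsub hx)
  nlinarith [h₁.nonneg hx]

/-- Difference of the energies `z² / 2 + G` of an upper and a lower branch in the Liénard plane. -/
lemma hasDerivAt_energy_sub (hu : IsBranch a (-δ) α u) (hl : IsBranch a δ α l) {x : ℝ}
    (hx : x ∈ Ioo 0 α) :
    HasDerivAt (fun x ↦ ((u x + δ * (a * x + x ^ 3 / 3)) ^ 2
        - (l x - δ * (a * x + x ^ 3 / 3)) ^ 2) / 2)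
      (-(x * (x ^ 2 - 1) ^ 2 * (δ * (a * x + x ^ 3 / 3))) * (1 / u x + 1 / l x)) x := by
  have pu := hu.pos x ⟨hx.1.le, hx.2⟩
  have pl := hl.pos x ⟨hx.1.le, hx.2⟩
  have hF : HasDerivAt (fun x : ℝ ↦ δ * (a * x + x ^ 3 / 3)) (δ * (a + x ^ 2)) x := by
    refine ((((hasDerivAt_id x).const_mul a).add
      ((hasDerivAt_pow 3 x).div_const 3)).const_mul δ).congr_deriv ?_
    norm_num
  refine (((((hu.hasDerivAt x hx).add hF).pow 2).sub
    (((hl.hasDerivAt x hx).sub hF).pow 2)).div_const 2).congr_deriv ?_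
  simp only [Pi.add_apply, Pi.sub_apply]
  field_simp
  ring

lemma hasDerivAt_sq_sub_sq (hu : IsBranch a (-δ) α u) (hl : IsBranch a δ α l) {x : ℝ}
    (hx : x ∈ Ioo 0 α) :
    HasDerivAt (fun x ↦ (u x ^ 2 - l x ^ 2) / 2) (-(δ * (a + x ^ 2) * (u x + l x))) x := by
  have pu := hu.pos x ⟨hx.1.le, hx.2⟩
  have pl := hl.pos x ⟨hx.1.le, hx.2⟩
  refine ((((hu.hasDerivAt x hx).pow 2).sub ((hl.hasDerivAt x hx).pow 2)).div_const 2).congr_deriv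
    ?_
  field_simp
  ring

lemma continuousOn_energy_sub (hu : IsBranch a (-δ) α u) (hl : IsBranch a δ α l) :
    ContinuousOn (fun x ↦ ((u x + δ * (a * x + x ^ 3 / 3)) ^ 2
        - (l x - δ * (a * x + x ^ 3 / 3)) ^ 2) / 2) (Icc 0 α) :=
  (((hu.continuousOn.add (by fun_prop)).pow 2).sub
    ((hl.continuousOn.sub (by fun_prop)).pow 2)).div_const 2

lemma continuousOn_sq_sub_sq (hu : IsBranch a (-δ) α u) (hl : IsBranch a δ α l) :
    ContinuousOn (fun x ↦ (u x ^ 2 - l x ^ 2) / 2) (Icc 0 α) :=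
  ((hu.continuousOn.pow 2).sub (hl.continuousOn.pow 2)).div_const 2

/-- A symmetric closed orbit leaves the strip in which `a + x² / 3 ≤ 0`. -/
lemma three_mul_lt_sq (hδ : 0 < δ) (hu : IsBranch a (-δ) α u) (hl : IsBranch a δ α l)
    (h0 : u 0 = l 0) : -(3 * a) < α ^ 2 := by
  by_contra! hα
  have hα0 := hu.pos_right
  have hsign : ∀ x ∈ Ioo 0 α, x * (δ * (a * x + x ^ 3 / 3)) < 0 := fun x hx ↦ by
    have h1 : x ^ 2 < α ^ 2 := by nlinarith [hx.1, hx.2]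
    have h2 : x * (δ * (a * x + x ^ 3 / 3)) = δ * x ^ 2 * (a + x ^ 2 / 3) := by ring
    rw [h2]
    exact mul_neg_of_pos_of_neg (by have := hx.1; positivity) (by linarith)
  have hinv : ∀ x ∈ Ioo 0 α, 0 < 1 / u x + 1 / l x := fun x hx ↦ by
    have pu := hu.pos x ⟨hx.1.le, hx.2⟩
    have pl := hl.pos x ⟨hx.1.le, hx.2⟩
    positivity
  have hmono := monotoneOn_of_hasDerivWithinAt_nonneg (convex_Icc 0 α)
    (continuousOn_energy_sub hu hl)
    (fun x hx ↦ (hasDerivAt_energy_sub hu hl (by rwa [interior_Icc] at hx)).hasDerivWithinAt)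
    (fun x hx ↦ by
      rw [interior_Icc] at hx
      have h1 := hsign x hx
      have h2 : -(x * (x ^ 2 - 1) ^ 2 * (δ * (a * x + x ^ 3 / 3)))
        = (x ^ 2 - 1) ^ 2 * -(x * (δ * (a * x + x ^ 3 / 3))) := by ring
      rw [h2]
      exact mul_nonneg (mul_nonneg (sq_nonneg _) (by linarith)) (hinv x hx).le)
  have hconst : ∀ x ∈ Icc 0 α, ((u x + δ * (a * x + x ^ 3 / 3)) ^ 2
        - (l x - δ * (a * x + x ^ 3 / 3)) ^ 2) / 2 = 0 := fun x hx ↦ by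
    have h1 := hmono (left_mem_Icc.2 hα0.le) hx hx.1
    have h2 := hmono hx (right_mem_Icc.2 hα0.le) hx.2
    simp only [h0, hu.eq_zero, hl.eq_zero] at h1 h2
    ring_nf at h1 h2 ⊢
    linarith
  set x := min α 1 / 2 with hxdef
  have hmin : 0 < min α 1 := lt_min hα0 one_pos
  have hx : x ∈ Ioo 0 α := ⟨by positivity, by have := min_le_left α 1; linarith⟩
  have hx1 : x < 1 := by have := min_le_right α 1; linarith
  have hd := hasDerivAt_energy_sub hu hl hx
  have hd0 : HasDerivAt (fun x ↦ ((u x + δ * (a * x + x ^ 3 / 3)) ^ 2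
        - (l x - δ * (a * x + x ^ 3 / 3)) ^ 2) / 2) 0 x :=
    (hasDerivAt_const x (0 : ℝ)).congr_of_eventuallyEq (by
      filter_upwards [Ioo_mem_nhds hx.1 hx.2] with t ht
      exact hconst t (Ioo_subset_Icc_self ht))
  have heq := hd.unique hd0
  have h1 := hsign x hx
  have h2 : -(x * (x ^ 2 - 1) ^ 2 * (δ * (a * x + x ^ 3 / 3)))
    = (x ^ 2 - 1) ^ 2 * -(x * (δ * (a * x + x ^ 3 / 3))) := by ring
  rw [h2] at heq
  have h3 : x ^ 2 - 1 ≠ 0 := by nlinarith [hx.1]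
  have h4 : 0 < (x ^ 2 - 1) ^ 2 * -(x * (δ * (a * x + x ^ 3 / 3))) :=
    mul_pos (by positivity) (by linarith)
  exact (mul_pos h4 (hinv x hx)).ne' heq

/-- Liénard's comparison of two nested symmetric closed orbits. -/
lemma false_of_lt (hδ : 0 < δ) (ha : a < 0)
    (hu₁ : IsBranch a (-δ) α₁ u₁) (hl₁ : IsBranch a δ α₁ l₁)
    (hu₂ : IsBranch a (-δ) α₂ u₂) (hl₂ : IsBranch a δ α₂ l₂)
    (h₁ : u₁ 0 = l₁ 0) (h₂ : u₂ 0 = l₂ 0) (hα : α₁ < α₂) : False := by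
  have hα₁ := hu₁.pos_right
  have hlarge := three_mul_lt_sq hδ hu₁ hl₁ h₁
  obtain ⟨c, hc0, hc⟩ : ∃ c : ℝ, 0 < c ∧ c ^ 2 = -(3 * a) :=
    ⟨√(-(3 * a)), Real.sqrt_pos.2 (by linarith), Real.sq_sqrt (by linarith)⟩
  have hcα : c < α₁ := by nlinarith
  have hFc : δ * (a * c + c ^ 3 / 3) = 0 := by
    have : c ^ 3 = c * c ^ 2 := by ring
    rw [this, hc]; ring
  have ltu : ∀ {x}, x ∈ Icc 0 α₁ → u₁ x < u₂ x := fun hx ↦ hu₁.lt hu₂ hα hx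
  have ltl : ∀ {x}, x ∈ Icc 0 α₁ → l₁ x < l₂ x := fun hx ↦ hl₁.lt hl₂ hα hx
  have hanti := antitoneOn_of_hasDerivWithinAt_nonpos (convex_Icc 0 c)
    (((continuousOn_energy_sub hu₂ hl₂).mono (Icc_subset_Icc_right (hcα.trans hα).le)).sub
      ((continuousOn_energy_sub hu₁ hl₁).mono (Icc_subset_Icc_right hcα.le)))
    (fun x hx ↦ by
      rw [interior_Icc] at hx
      exact ((hasDerivAt_energy_sub hu₂ hl₂ ⟨hx.1, hx.2.trans (hcα.trans hα)⟩).sub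
        (hasDerivAt_energy_sub hu₁ hl₁ ⟨hx.1, hx.2.trans hcα⟩)).hasDerivWithinAt)
    (fun x hx ↦ by
      rw [interior_Icc] at hx
      have hx' : x ∈ Icc 0 α₁ := ⟨hx.1.le, (hx.2.trans hcα).le⟩
      have pu := hu₁.pos x ⟨hx.1.le, hx.2.trans hcα⟩
      have pl := hl₁.pos x ⟨hx.1.le, hx.2.trans hcα⟩
      have iu := one_div_le_one_div_of_le pu (ltu hx').le
      have il := one_div_le_one_div_of_le pl (ltl hx').le
      have hF : -(x * (x ^ 2 - 1) ^ 2 * (δ * (a * x + x ^ 3 / 3)))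
        = (δ * (x ^ 2 * (x ^ 2 - 1) ^ 2)) * (-a - x ^ 2 / 3) := by ring
      have hsq : x ^ 2 < c ^ 2 := by nlinarith [hx.1, hx.2]
      have hF0 : 0 ≤ -(x * (x ^ 2 - 1) ^ 2 * (δ * (a * x + x ^ 3 / 3))) := by
        rw [hF]
        exact mul_nonneg (by positivity) (by linarith)
      nlinarith [mul_nonneg hF0 (by linarith : 0 ≤ 1 / u₁ x + 1 / l₁ x - (1 / u₂ x + 1 / l₂ x))])
  have hE := hanti (left_mem_Icc.2 hc0.le) (right_mem_Icc.2 hc0.le) hc0.le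
  have hmid := strictAntiOn_of_hasDerivWithinAt_neg (convex_Icc c α₁)
    (((continuousOn_sq_sub_sq hu₂ hl₂).mono (Icc_subset_Icc hc0.le hα.le)).sub
      ((continuousOn_sq_sub_sq hu₁ hl₁).mono (Icc_subset_Icc_left hc0.le)))
    (fun x hx ↦ by
      rw [interior_Icc] at hx
      exact ((hasDerivAt_sq_sub_sq hu₂ hl₂ ⟨hc0.trans hx.1, hx.2.trans hα⟩).sub
        (hasDerivAt_sq_sub_sq hu₁ hl₁ ⟨hc0.trans hx.1, hx.2⟩)).hasDerivWithinAt)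
    (fun x hx ↦ by
      rw [interior_Icc] at hx
      have hx' : x ∈ Icc 0 α₁ := ⟨(hc0.trans hx.1).le, hx.2.le⟩
      have hf : 0 < δ * (a + x ^ 2) := mul_pos hδ (by nlinarith [hx.1])
      nlinarith [mul_pos hf (by linarith [ltu hx', ltl hx'] :
        0 < u₂ x + l₂ x - (u₁ x + l₁ x))])
  have hJ := hmid (left_mem_Icc.2 hcα.le) (right_mem_Icc.2 hcα.le) hcα
  have hend := strictAntiOn_of_hasDerivWithinAt_neg (convex_Icc α₁ α₂)
    ((continuousOn_sq_sub_sq hu₂ hl₂).mono (Icc_subset_Icc_left hα₁.le))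
    (fun x hx ↦ by
      rw [interior_Icc] at hx
      exact (hasDerivAt_sq_sub_sq hu₂ hl₂ ⟨hα₁.trans hx.1, hx.2⟩).hasDerivWithinAt)
    (fun x hx ↦ by
      rw [interior_Icc] at hx
      have pu := hu₂.pos x ⟨(hα₁.trans hx.1).le, hx.2⟩
      have pl := hl₂.pos x ⟨(hα₁.trans hx.1).le, hx.2⟩
      have hf : 0 < δ * (a + x ^ 2) := mul_pos hδ (by nlinarith [hx.1])
      have := mul_pos hf (add_pos pu pl)
      linarith)
  have hJ₂ := hend (left_mem_Icc.2 hα.le) (right_mem_Icc.2 hα.le) hα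
  simp only [Pi.sub_apply, hFc, h₁, h₂, hu₁.eq_zero, hl₁.eq_zero, hu₂.eq_zero, hl₂.eq_zero]
    at hE hJ hJ₂
  ring_nf at hE hJ hJ₂
  linarith

end IsBranch

/-- The time reversal of a plane curve, reflected in the `x`-axis. -/
def timeReversal (γ : ℝ → ℝ × ℝ) (t : ℝ) : ℝ × ℝ := ((γ (-t)).1, -(γ (-t)).2)

namespace IsSolIIm1

variable {a δ : ℝ} {γ γ₁ γ₂ : ℝ → ℝ × ℝ}

lemma hasDerivAt_fst (h : IsSolIIm1 a δ γ) (t : ℝ) :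
    HasDerivAt (fun t ↦ (γ t).1) (γ t).2 t :=
  (h t).fst

lemma hasDerivAt_snd (h : IsSolIIm1 a δ γ) (t : ℝ) :
    HasDerivAt (fun t ↦ (γ t).2)
      (-((γ t).1 * ((γ t).1 ^ 2 - 1) ^ 2) - δ * (a + (γ t).1 ^ 2) * (γ t).2) t :=
  (h t).snd

lemma continuous (h : IsSolIIm1 a δ γ) : Continuous γ :=
  continuous_iff_continuousAt.2 fun t ↦ (h t).continuousAt

lemma neg (h : IsSolIIm1 a δ γ) : IsSolIIm1 a δ (fun t ↦ -γ t) := fun t ↦ by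
  refine (h t).neg.congr_deriv ?_
  ext
  · simp
  · simp only [Prod.snd_neg, Prod.fst_neg]
    ring

lemma comp_add (h : IsSolIIm1 a δ γ) (c : ℝ) : IsSolIIm1 a δ (fun t ↦ γ (t + c)) :=
  fun t ↦ (h (t + c)).comp_add_const t c

/-- The time reversal of a solution solves the system with opposite damping. -/
lemma reverse (h : IsSolIIm1 a δ γ) : IsSolIIm1 a (-δ) (timeReversal γ) := fun t ↦ by
  have h₁ := (h.hasDerivAt_fst (-t)).scomp t (hasDerivAt_neg t)
  have h₂ := ((h.hasDerivAt_snd (-t)).scomp t (hasDerivAt_neg t)).neg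
  refine (h₁.prodMk h₂).congr_deriv ?_
  ext
  · simp [timeReversal]
  · simp only [timeReversal, smul_eq_mul]
    ring

/-- Bounded solutions through a common point agree up to a translation of time. -/
lemma eq_of_eq (h₁ : IsSolIIm1 a δ γ₁) (h₂ : IsSolIIm1 a δ γ₂)
    (b₁ : Bornology.IsBounded (range γ₁)) (b₂ : Bornology.IsBounded (range γ₂))
    {t₁ t₂ : ℝ} (heq : γ₁ t₁ = γ₂ t₂) (t : ℝ) : γ₁ (t + t₁) = γ₂ (t + t₂) := by
  obtain ⟨R, hR⟩ := (b₁.union b₂).subset_closedBall 0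
  let V : ℝ × ℝ → ℝ × ℝ := fun p ↦ (p.2, -(p.1 * (p.1 ^ 2 - 1) ^ 2) - δ * (a + p.1 ^ 2) * p.2)
  have hV : ContDiff ℝ 1 V := by fun_prop
  obtain ⟨K, hK⟩ := hV.contDiffOn.exists_lipschitzOnWith (s := Metric.closedBall 0 R)
    one_ne_zero (convex_closedBall 0 R) (isCompact_closedBall 0 R)
  have := ODE_solution_unique_univ (v := fun _ ↦ V) (s := fun _ ↦ Metric.closedBall 0 R)
    (f := fun t ↦ γ₁ (t + t₁)) (g := fun t ↦ γ₂ (t + t₂)) (t₀ := 0) (fun _ ↦ hK)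
    (fun t ↦ ⟨h₁.comp_add t₁ t, hR (Or.inl (mem_range_self _))⟩)
    (fun t ↦ ⟨h₂.comp_add t₂ t, hR (Or.inr (mem_range_self _))⟩) (by simpa using heq)
  exact congrFun this t

end IsSolIIm1

/-- The first zero to the right of a point where a continuous function is positive. -/
lemma exists_first_zero {f : ℝ → ℝ} {a b : ℝ} (hf : Continuous f) (hab : a ≤ b) (ha : 0 < f a)
    (hb : f b ≤ 0) : ∃ c ∈ Ioc a b, f c = 0 ∧ ∀ t ∈ Ico a c, 0 < f t := by
  obtain ⟨c, ⟨hc, hc0⟩, hmin⟩ :=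
    (isCompact_Icc.inter_right (isClosed_le hf continuous_const)).exists_isLeast
      (⟨b, right_mem_Icc.2 hab, hb⟩ : (Icc a b ∩ {t | f t ≤ 0}).Nonempty)
  have hac : a < c := lt_of_le_of_ne hc.1 (by rintro rfl; exact absurd hc0 (not_le.2 ha))
  have hpos : ∀ t ∈ Ico a c, 0 < f t := fun t ht ↦ by
    by_contra! h
    exact absurd (hmin ⟨⟨ht.1, ht.2.le.trans hc.2⟩, h⟩) (not_le.2 ht.2)
  refine ⟨c, ⟨hac, hc.2⟩, le_antisymm hc0 ?_, hpos⟩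
  refine ge_of_tendsto (hf.continuousWithinAt (s := Iio c)) ?_
  filter_upwards [Ico_mem_nhdsLT hac] with t ht using (hpos t ht).le

/-- A function with negative derivative at one of its zeros changes sign there. -/
lemma HasDerivAt.exists_sign_change {f : ℝ → ℝ} {d t : ℝ} (hf : HasDerivAt f d t) (hd : d < 0)
    (h0 : f t = 0) :
    ∃ ε > 0, (∀ s ∈ Ioo (t - ε) t, 0 < f s) ∧ ∀ s ∈ Ioo t (t + ε), f s < 0 := by
  have h1 := (hasDerivAt_iff_tendsto_slope.1 hf).eventually (gt_mem_nhds hd)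
  rw [eventually_nhdsWithin_iff, Metric.eventually_nhds_iff] at h1
  obtain ⟨ε, hε, h⟩ := h1
  refine ⟨ε, hε, fun s hs ↦ ?_, fun s hs ↦ ?_⟩
  · have := h (y := s) (by rw [Real.dist_eq, abs_lt]; constructor <;> linarith [hs.1, hs.2])
      hs.2.ne
    rw [slope_def_field, h0, sub_zero, div_lt_iff_of_neg (by linarith [hs.2])] at this
    linarith
  · have := h (y := s) (by rw [Real.dist_eq, abs_lt]; constructor <;> linarith [hs.1, hs.2])
      hs.1.ne'
    rw [slope_def_field, h0, sub_zero, div_lt_iff₀ (by linarith [hs.1])] at this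
    linarith

namespace IsNonconstPeriodicSolIIm1

variable {a δ : ℝ} {γ γ₁ γ₂ : ℝ → ℝ × ℝ}

lemma isCompact_range (h : IsNonconstPeriodicSolIIm1 a δ γ) : IsCompact (range γ) := by
  obtain ⟨hs, ⟨T, hT, hp⟩, -⟩ := h
  exact Function.Periodic.compact_of_continuous hp hT.ne' hs.continuous

lemma neg (h : IsNonconstPeriodicSolIIm1 a δ γ) :
    IsNonconstPeriodicSolIIm1 a δ (fun t ↦ -γ t) := by
  obtain ⟨hs, ⟨T, hT, hp⟩, hc⟩ := h
  refine ⟨hs.neg, ⟨T, hT, fun t ↦ by simp only [hp]⟩, fun h ↦ hc fun t s ↦ neg_injective (h t s)⟩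

lemma reverse (h : IsNonconstPeriodicSolIIm1 a δ γ) :
    IsNonconstPeriodicSolIIm1 a (-δ) (timeReversal γ) := by
  obtain ⟨hs, ⟨T, hT, hp⟩, hc⟩ := h
  refine ⟨hs.reverse, ⟨T, hT, fun t ↦ ?_⟩, fun h ↦ hc fun t s ↦ ?_⟩
  · have : γ (-(t + T)) = γ (-t) := by rw [← hp (-(t + T))]; congr 1; ring
    simp only [timeReversal, this]
  · have := h (-t) (-s)
    simp only [timeReversal, neg_neg, Prod.mk.injEq, neg_inj] at this
    exact Prod.ext this.1 this.2

lemma eq_of_eq (h₁ : IsNonconstPeriodicSolIIm1 a δ γ₁) (h₂ : IsNonconstPeriodicSolIIm1 a δ γ₂)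
    {t₁ t₂ : ℝ} (heq : γ₁ t₁ = γ₂ t₂) (t : ℝ) : γ₁ (t + t₁) = γ₂ (t + t₂) :=
  h₁.1.eq_of_eq h₂.1 h₁.isCompact_range.isBounded h₂.isCompact_range.isBounded heq t

lemma not_equilibrium (h : IsNonconstPeriodicSolIIm1 a δ γ) {t : ℝ} (hy : (γ t).2 = 0) :
    (γ t).1 * ((γ t).1 ^ 2 - 1) ^ 2 ≠ 0 := by
  intro hx
  have hconst : IsSolIIm1 a δ (fun _ ↦ γ t) := fun s ↦ by
    refine (hasDerivAt_const s (γ t)).congr_deriv ?_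
    simp only [hy, hx]
    ext <;> simp
  have key : ∀ s, γ s = γ t := fun s ↦ by
    simpa using h.1.eq_of_eq hconst h.isCompact_range.isBounded
      (isCompact_singleton.isBounded.subset (range_subset_iff.2 fun _ ↦ mem_singleton (γ t)))
      (t₁ := t) (t₂ := t) rfl (s - t)
  exact h.2.2 fun s r ↦ (key s).trans (key r).symm

lemma sign_change (h : IsNonconstPeriodicSolIIm1 a δ γ) {t : ℝ} (hx : 0 < (γ t).1)
    (hy : (γ t).2 = 0) : ∃ ε > 0, (∀ s ∈ Ioo (t - ε) t, 0 < (γ s).2) ∧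
      ∀ s ∈ Ioo t (t + ε), (γ s).2 < 0 := by
  refine (h.1.hasDerivAt_snd t).exists_sign_change ?_ hy
  have := h.not_equilibrium hy
  have : 0 < (γ t).1 * ((γ t).1 ^ 2 - 1) ^ 2 := lt_of_le_of_ne (by positivity) this.symm
  rw [hy]
  linarith

/-- The abscissa has a positive maximum. -/
lemma exists_max (h : IsNonconstPeriodicSolIIm1 a δ γ) :
    ∃ m, 0 < (γ m).1 ∧ ∀ t, (γ t).1 ≤ (γ m).1 := by
  obtain ⟨_, ⟨m, rfl⟩, hm⟩ := h.isCompact_range.exists_isMaxOn (range_nonempty γ)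
    continuous_fst.continuousOn
  have hmax : ∀ t, (γ t).1 ≤ (γ m).1 := fun t ↦ hm (mem_range_self t)
  refine ⟨m, ?_, hmax⟩
  by_contra! hneg
  have hy : (γ m).2 = 0 := IsLocalMax.hasDerivAt_eq_zero (.of_forall hmax) (h.1.hasDerivAt_fst m)
  have hx : (γ m).1 ≠ 0 := fun h0 ↦ h.not_equilibrium hy (by rw [h0, zero_mul])
  obtain ⟨ε, hε, -, h2⟩ := h.neg.sign_change (t := m)
    (by simpa using lt_of_le_of_ne hneg hx) (by simpa using hy)
  have := strictMonoOn_of_hasDerivWithinAt_pos (convex_Icc m (m + ε))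
    (fun t _ ↦ (h.1.hasDerivAt_fst t).continuousAt.continuousWithinAt)
    (fun t _ ↦ (h.1.hasDerivAt_fst t).hasDerivWithinAt)
    (fun t ht ↦ by rw [interior_Icc] at ht; simpa using h2 t ht)
    (left_mem_Icc.2 (by linarith)) (right_mem_Icc.2 (by linarith)) (by linarith : m < m + ε)
  exact absurd (hmax (m + ε)) (not_le.2 this)

lemma exists_neg_after (h : IsNonconstPeriodicSolIIm1 a δ γ) (t : ℝ) :
    ∃ s, t < s ∧ (γ s).1 < 0 := by
  obtain ⟨m, hm, -⟩ := h.neg.exists_max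
  obtain ⟨-, ⟨T, hT, hp⟩, -⟩ := h
  obtain ⟨n, hn⟩ := exists_nat_gt ((t - m) / T)
  refine ⟨m + n * T, ?_, ?_⟩
  · rw [div_lt_iff₀ hT] at hn
    linarith
  · rw [(Function.Periodic.nat_mul (f := γ) hp n) m]
    simpa using hm

end IsNonconstPeriodicSolIIm1

/-- On the time interval `[m, s]` the curve `γ` runs through the fourth quadrant from the positive
`x`-axis to the negative `y`-axis. -/
structure IsForwardArc (γ : ℝ → ℝ × ℝ) (m s : ℝ) : Prop where
  lt : m < s
  snd_left : (γ m).2 = 0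
  fst_right : (γ s).1 = 0
  fst_pos : ∀ t ∈ Ico m s, 0 < (γ t).1
  snd_neg : ∀ t ∈ Ioc m s, (γ t).2 < 0

namespace IsNonconstPeriodicSolIIm1

variable {a δ : ℝ} {γ γ₁ γ₂ : ℝ → ℝ × ℝ} {m s t m₁ m₂ s₁ s₂ r₁ r₂ : ℝ}

lemma snd_eq_zero_of_max (h : IsNonconstPeriodicSolIIm1 a δ γ)
    (hmax : ∀ t, (γ t).1 ≤ (γ m).1) : (γ m).2 = 0 :=
  IsLocalMax.hasDerivAt_eq_zero (.of_forall hmax) (h.1.hasDerivAt_fst m)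

lemma continuous_snd (h : IsNonconstPeriodicSolIIm1 a δ γ) : Continuous fun t ↦ (γ t).2 :=
  h.1.continuous.snd

lemma exists_arc_from (h : IsNonconstPeriodicSolIIm1 a δ γ) (hx : 0 < (γ m).1)
    (hy : (γ m).2 = 0) : ∃ s, IsForwardArc γ m s := by
  obtain ⟨b, hmb, hb⟩ := h.exists_neg_after m
  obtain ⟨s, hs, hs0, hpos⟩ := exists_first_zero h.1.continuous.fst hmb.le hx hb.le
  obtain ⟨ε, hε, -, hright⟩ := h.sign_change hx hy
  have hneg : ∀ t ∈ Ioo m s, (γ t).2 < 0 := by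
    intro t ht
    by_contra! hcon
    obtain ⟨t₁, ht₁, ht₁'⟩ := exists_between (lt_min (lt_add_of_pos_right m hε) ht.1)
    obtain ⟨c, hc, hc0, hcpos⟩ := exists_first_zero h.continuous_snd.neg
      (ht₁'.trans_le (min_le_right _ _)).le
      (neg_pos.2 (hright t₁ ⟨ht₁, ht₁'.trans_le (min_le_left _ _)⟩)) (neg_nonpos.2 hcon)
    obtain ⟨ε', hε', hleft, -⟩ := h.sign_change (t := c)
      (hpos c ⟨(ht₁.trans hc.1).le, hc.2.trans_lt ht.2⟩) (neg_eq_zero.1 hc0)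
    obtain ⟨r, hr, hr'⟩ := exists_between (max_lt (sub_lt_self c hε') hc.1)
    have p₁ := hleft r ⟨(le_max_left _ _).trans_lt hr, hr'⟩
    have p₂ := hcpos r ⟨((le_max_right _ _).trans_lt hr).le, hr'⟩
    simp only [Pi.neg_apply] at p₂
    linarith
  refine ⟨s, hs.1, hy, hs0, hpos, fun t ht ↦ ?_⟩
  rcases ht.2.lt_or_eq with hlt | rfl
  · exact hneg t ⟨ht.1, hlt⟩
  · refine lt_of_le_of_ne (le_of_tendsto (h.continuous_snd.continuousWithinAt (s := Iio t)) ?_)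
      fun h0 ↦ h.not_equilibrium h0 (by rw [hs0, zero_mul])
    filter_upwards [Ioo_mem_nhdsLT ht.1] with r hr using (hneg r hr).le

lemma strictAntiOn_fst (h : IsNonconstPeriodicSolIIm1 a δ γ)
    (hneg : ∀ t ∈ Ioc m s, (γ t).2 < 0) : StrictAntiOn (fun t ↦ (γ t).1) (Icc m s) :=
  strictAntiOn_of_hasDerivWithinAt_neg (convex_Icc m s) h.1.continuous.fst.continuousOn
    (fun t _ ↦ (h.1.hasDerivAt_fst t).hasDerivWithinAt)
    fun t ht ↦ hneg t (Ioo_subset_Ioc_self (by rwa [interior_Icc] at ht))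

lemma exists_arc_to (h : IsNonconstPeriodicSolIIm1 a δ γ) (hx : (γ s).1 = 0)
    (hy : (γ s).2 < 0) : ∃ m, IsForwardArc γ m s := by
  obtain ⟨T, hT, hp⟩ := h.2.1
  obtain ⟨b, hb, hb0⟩ := exists_hasDerivAt_eq_zero (sub_lt_self s hT)
    h.1.continuous.fst.continuousOn
    (by have := hp (s - T); rw [sub_add_cancel] at this; simp only [this])
    (fun t _ ↦ h.1.hasDerivAt_fst t)
  obtain ⟨c, hc, hc0, hcpos⟩ := exists_first_zero (f := fun t ↦ -(γ (-t)).2)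
    (h.continuous_snd.comp continuous_neg).neg (neg_le_neg hb.2.le) (by simpa using hy)
    (by simp [hb0])
  have hneg : ∀ t ∈ Ioc (-c) s, (γ t).2 < 0 := fun t ht ↦ by
    simpa using hcpos (-t) ⟨neg_le_neg ht.2, by linarith [ht.1]⟩
  have hcs : -c < s := by linarith [hc.1]
  refine ⟨-c, hcs, by simpa using hc0, hx, fun t ht ↦ ?_, hneg⟩
  have := h.strictAntiOn_fst hneg (Ico_subset_Icc_self ht) (right_mem_Icc.2 hcs.le) ht.2
  simpa [hx] using this

lemma exists_isBranch (h : IsNonconstPeriodicSolIIm1 a δ γ) (harc : IsForwardArc γ m s) :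
    ∃ w, IsBranch a δ (γ m).1 w ∧ w 0 = -(γ s).2 := by
  set X : ℝ → ℝ := fun t ↦ (γ t).1
  have hXc : Continuous X := h.1.continuous.fst
  have hanti : StrictAntiOn X (Icc m s) := h.strictAntiOn_fst harc.snd_neg
  have hXm : X m = (γ m).1 := rfl
  have hsurj : ∀ x ∈ Icc 0 (X m), x ∈ X '' Icc m s := fun x hx ↦
    intermediate_value_Icc' harc.lt.le hXc.continuousOn (by rwa [show X s = 0 from harc.fst_right])
  set τ : ℝ → ℝ := Function.invFunOn X (Icc m s)
  have hτ : ∀ x ∈ Icc 0 (X m), τ x ∈ Icc m s ∧ X (τ x) = x := fun x hx ↦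
    Function.invFunOn_pos (hsurj x hx)
  have hτX : ∀ t ∈ Icc m s, τ (X t) = t := fun t ht ↦ hanti.injOn.leftInvOn_invFunOn ht
  have hmaps : ∀ t ∈ Icc m s, X t ∈ Icc 0 (X m) := fun t ht ↦
    ⟨harc.fst_right.ge.trans (hanti.antitoneOn ht (right_mem_Icc.2 harc.lt.le) ht.2),
      hanti.antitoneOn (left_mem_Icc.2 harc.lt.le) ht ht.1⟩
  have hτc : ContinuousOn τ (Icc 0 (X m)) := by
    refine continuousOn_iff_isClosed.2 fun K hK ↦ ⟨X '' (Icc m s ∩ K),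
      ((isCompact_Icc.inter_right hK).image hXc).isClosed, ?_⟩
    ext x
    constructor
    · rintro ⟨hxK, hx⟩
      exact ⟨⟨τ x, ⟨(hτ x hx).1, hxK⟩, (hτ x hx).2⟩, hx⟩
    · rintro ⟨⟨t, ⟨ht, htK⟩, rfl⟩, hx⟩
      exact ⟨by rw [mem_preimage, hτX t ht]; exact htK, hx⟩
  have hτm : τ (X m) = m := hτX m (left_mem_Icc.2 harc.lt.le)
  have hτs : τ 0 = s := by
    have := hτX s (right_mem_Icc.2 harc.lt.le)
    rwa [show X s = 0 from harc.fst_right] at this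
  have hτlt : ∀ x ∈ Ico 0 (X m), τ x ∈ Ioc m s := fun x hx ↦ by
    obtain ⟨h₁, h₂⟩ := hτ x (Ico_subset_Icc_self hx)
    refine ⟨lt_of_le_of_ne h₁.1 fun heq ↦ hx.2.ne ?_, h₁.2⟩
    rw [← h₂, ← heq]
  refine ⟨fun x ↦ -(γ (τ x)).2, ⟨harc.fst_pos m (left_mem_Ico.2 harc.lt),
    (h.continuous_snd.comp_continuousOn hτc).neg,
    fun x hx ↦ neg_pos.2 (harc.snd_neg _ (hτlt x hx)), ?_, fun x hx ↦ ?_⟩, ?_⟩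
  · simp only [← hXm, hτm, harc.snd_left, neg_zero]
  · have hne : (γ (τ x)).2 ≠ 0 := (harc.snd_neg _ (hτlt x (Ioo_subset_Ico_self hx))).ne
    have hXτ : (γ (τ x)).1 = x := (hτ x (Ioo_subset_Icc_self hx)).2
    have hτd : HasDerivAt τ ((γ (τ x)).2)⁻¹ x :=
      HasDerivAt.of_local_left_inverse (hτc.continuousAt (Icc_mem_nhds hx.1 hx.2))
        (h.1.hasDerivAt_fst (τ x)) hne (by
          filter_upwards [Icc_mem_nhds hx.1 hx.2] with t ht using (hτ t ht).2)
    refine ((h.1.hasDerivAt_snd (τ x)).comp x hτd).neg.congr_deriv ?_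
    rw [hXτ]
    field_simp
    ring
  · simp only [hτs]

lemma eq_of_arcs (h₁ : IsNonconstPeriodicSolIIm1 a δ γ₁) (h₂ : IsNonconstPeriodicSolIIm1 a δ γ₂)
    (arc₁ : IsForwardArc γ₁ m₁ s₁) (arc₂ : IsForwardArc γ₂ m₂ s₂)
    (heq : (γ₁ m₁).1 = (γ₂ m₂).1) : γ₁ s₁ = γ₂ s₂ := by
  have hshift := h₁.eq_of_eq h₂ (Prod.ext heq (arc₁.snd_left.trans arc₂.snd_left.symm))
  have e₁ : γ₁ s₁ = γ₂ (s₁ - m₁ + m₂) := by simpa using hshift (s₁ - m₁)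
  have e₂ : γ₁ (s₂ - m₂ + m₁) = γ₂ s₂ := by simpa using hshift (s₂ - m₂)
  rcases lt_trichotomy (s₁ - m₁) (s₂ - m₂) with hlt | hst | hlt
  · have := arc₂.fst_pos (s₁ - m₁ + m₂) ⟨by linarith [arc₁.lt], by linarith⟩
    rw [← e₁, arc₁.fst_right] at this
    exact absurd this (lt_irrefl 0)
  · rw [e₁, hst, sub_add_cancel]
  · have := arc₁.fst_pos (s₂ - m₂ + m₁) ⟨by linarith [arc₂.lt], by linarith⟩
    rw [e₂, arc₂.fst_right] at this
    exact absurd this (lt_irrefl 0)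

lemma snd_lt_of_arcs (h₁ : IsNonconstPeriodicSolIIm1 a δ γ₁)
    (h₂ : IsNonconstPeriodicSolIIm1 a δ γ₂)
    (arc₁ : IsForwardArc γ₁ m₁ s₁) (arc₂ : IsForwardArc γ₂ m₂ s₂)
    (hlt : (γ₁ m₁).1 < (γ₂ m₂).1) : (γ₂ s₂).2 < (γ₁ s₁).2 := by
  obtain ⟨w₁, hw₁, e₁⟩ := h₁.exists_isBranch arc₁
  obtain ⟨w₂, hw₂, e₂⟩ := h₂.exists_isBranch arc₂
  have := hw₁.lt hw₂ hlt (left_mem_Icc.2 hw₁.pos_right.le)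
  linarith

/-- The arc through the point with maximal abscissa ends in the lowest point of the orbit on the
`y`-axis. -/
lemma snd_le_of_fst_eq_zero (h : IsNonconstPeriodicSolIIm1 a δ γ)
    (hmax : ∀ t, (γ t).1 ≤ (γ m).1) (harc : IsForwardArc γ m s) (hx : (γ t).1 = 0)
    (hy : (γ t).2 < 0) : (γ s).2 ≤ (γ t).2 := by
  obtain ⟨n, hn⟩ := h.exists_arc_to hx hy
  rcases (hmax n).lt_or_eq with hlt | heq
  · exact (h.snd_lt_of_arcs h hn harc hlt).le
  · rw [h.eq_of_arcs h hn harc heq]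

lemma exists_max_arcs (h : IsNonconstPeriodicSolIIm1 a δ γ) :
    ∃ m s r, (∀ t, (γ t).1 ≤ (γ m).1) ∧ IsForwardArc γ m s ∧
      IsForwardArc (timeReversal γ) (-m) r := by
  obtain ⟨m, hm, hmax⟩ := h.exists_max
  have hy := h.snd_eq_zero_of_max hmax
  obtain ⟨s, hs⟩ := h.exists_arc_from hm hy
  obtain ⟨r, hr⟩ := h.reverse.exists_arc_from (m := -m) (by simpa [timeReversal] using hm)
    (by simpa [timeReversal] using hy)
  exact ⟨m, s, r, hmax, hs, hr⟩

/-- The maximal right arc of a periodic orbit meets the `y`-axis in two opposite points. -/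
lemma snd_eq_snd_of_max (h : IsNonconstPeriodicSolIIm1 a δ γ) {r : ℝ}
    (hmax : ∀ t, (γ t).1 ≤ (γ m).1) (hs : IsForwardArc γ m s)
    (hr : IsForwardArc (timeReversal γ) (-m) r) :
    (timeReversal γ r).2 = (γ s).2 := by
  obtain ⟨n, s', r', hmax', hs', hr'⟩ := h.neg.exists_max_arcs
  have hrev : ∀ {γ : ℝ → ℝ × ℝ} {m : ℝ}, (∀ t, (γ t).1 ≤ (γ m).1) →
      ∀ t, (timeReversal γ t).1 ≤ (timeReversal γ (-m)).1 := fun H t ↦ by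
    simpa [timeReversal] using H (-t)
  have hs₁ := hs.fst_right
  have hs₂ := hs.snd_neg s (right_mem_Ioc.2 hs.lt)
  have hr₁ := hr.fst_right
  have hr₂ := hr.snd_neg r (right_mem_Ioc.2 hr.lt)
  have hs'₁ := hs'.fst_right
  have hs'₂ := hs'.snd_neg s' (right_mem_Ioc.2 hs'.lt)
  have hr'₁ := hr'.fst_right
  have hr'₂ := hr'.snd_neg r' (right_mem_Ioc.2 hr'.lt)
  have q_le := h.neg.reverse.snd_le_of_fst_eq_zero (hrev hmax') hr' (t := -s)
    (by simpa [timeReversal] using hs₁) (by simpa [timeReversal] using hs₂)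
  have p_le := h.neg.snd_le_of_fst_eq_zero hmax' hs' (t := -r)
    (by simpa [timeReversal] using hr₁) (by simpa [timeReversal] using hr₂)
  have q'_le := h.reverse.snd_le_of_fst_eq_zero (hrev hmax) hr (t := -s')
    (by simpa [timeReversal] using hs'₁) (by simpa [timeReversal] using hs'₂)
  have p'_le := h.snd_le_of_fst_eq_zero hmax hs (t := -r')
    (by simpa [timeReversal] using hr'₁) (by simpa [timeReversal] using hr'₂)
  have hfst : ∀ (γ : ℝ → ℝ × ℝ) (m : ℝ), (timeReversal γ (-m)).1 = (γ m).1 := fun γ m ↦ by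
    simp [timeReversal]
  rcases lt_trichotomy (γ m).1 (-γ n).1 with hlt | heq | hlt
  · have c₁ := h.snd_lt_of_arcs h.neg hs hs' hlt
    have c₂ := h.reverse.snd_lt_of_arcs h.neg.reverse hr hr' (by simpa only [hfst] using hlt)
    simp only [timeReversal, neg_neg, Prod.snd_neg] at *
    linarith
  · have c₁ := congrArg Prod.snd (h.eq_of_arcs h.neg hs hs' heq)
    have c₂ := congrArg Prod.snd
      (h.reverse.eq_of_arcs h.neg.reverse hr hr' (by simpa only [hfst] using heq))
    simp only [timeReversal, neg_neg, Prod.snd_neg] at *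
    linarith
  · have c₁ := h.neg.snd_lt_of_arcs h hs' hs hlt
    have c₂ := h.neg.reverse.snd_lt_of_arcs h.reverse hr' hr (by simpa only [hfst] using hlt)
    simp only [timeReversal, neg_neg, Prod.snd_neg] at *
    linarith

lemma not_fst_lt_fst (hδ : 0 < δ) (ha : a < 0) (h₁ : IsNonconstPeriodicSolIIm1 a δ γ₁)
    (h₂ : IsNonconstPeriodicSolIIm1 a δ γ₂)
    (hmax₁ : ∀ t, (γ₁ t).1 ≤ (γ₁ m₁).1) (hs₁ : IsForwardArc γ₁ m₁ s₁)
    (hr₁ : IsForwardArc (timeReversal γ₁) (-m₁) r₁)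
    (hmax₂ : ∀ t, (γ₂ t).1 ≤ (γ₂ m₂).1) (hs₂ : IsForwardArc γ₂ m₂ s₂)
    (hr₂ : IsForwardArc (timeReversal γ₂) (-m₂) r₂) : ¬ (γ₁ m₁).1 < (γ₂ m₂).1 := by
  intro hlt
  have e₁ := h₁.snd_eq_snd_of_max hmax₁ hs₁ hr₁
  have e₂ := h₂.snd_eq_snd_of_max hmax₂ hs₂ hr₂
  obtain ⟨l₁, hl₁, el₁⟩ := h₁.exists_isBranch hs₁
  obtain ⟨l₂, hl₂, el₂⟩ := h₂.exists_isBranch hs₂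
  obtain ⟨u₁, hu₁, eu₁⟩ := h₁.reverse.exists_isBranch hr₁
  obtain ⟨u₂, hu₂, eu₂⟩ := h₂.reverse.exists_isBranch hr₂
  simp only [timeReversal, neg_neg] at hu₁ hu₂
  exact IsBranch.false_of_lt hδ ha hu₁ hl₁ hu₂ hl₂ (by rw [eu₁, el₁, e₁]) (by rw [eu₂, el₂, e₂]) hlt

end IsNonconstPeriodicSolIIm1

/-- for δ > 0, a2 < 0 and a1 = −1, any two nonconstant periodic
solutions of system (II) have the same image (at most one limit cycle). -/
theorem stmt9 (a2 δ : ℝ) (hδ : 0 < δ) (ha2 : a2 < 0) :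
    ∀ γ1 γ2 : ℝ → ℝ × ℝ, IsNonconstPeriodicSolIIm1 a2 δ γ1 →
      IsNonconstPeriodicSolIIm1 a2 δ γ2 → Set.range γ1 = Set.range γ2 := by
  intro γ₁ γ₂ h₁ h₂
  obtain ⟨m₁, s₁, r₁, hmax₁, hs₁, hr₁⟩ := h₁.exists_max_arcs
  obtain ⟨m₂, s₂, r₂, hmax₂, hs₂, hr₂⟩ := h₂.exists_max_arcs
  have hfst : (γ₁ m₁).1 = (γ₂ m₂).1 := le_antisymm
    (not_lt.1 (h₂.not_fst_lt_fst hδ ha2 h₁ hmax₂ hs₂ hr₂ hmax₁ hs₁ hr₁))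
    (not_lt.1 (h₁.not_fst_lt_fst hδ ha2 h₂ hmax₁ hs₁ hr₁ hmax₂ hs₂ hr₂))
  have hshift := h₁.eq_of_eq h₂ (Prod.ext hfst (hs₁.snd_left.trans hs₂.snd_left.symm))
  apply Subset.antisymm
  · rintro _ ⟨t, rfl⟩
    exact ⟨t - m₁ + m₂, by rw [← hshift, sub_add_cancel]⟩
  · rintro _ ⟨t, rfl⟩
    exact ⟨t - m₂ + m₁, by rw [hshift, sub_add_cancel]⟩
end

section
/- Let −1 < a1 < 0, δ > 0 and a2 ≥ (a1 − 1 − √(−a1))/3. If γ is a periodic solution of system (III) whose first component satisfies (γ t).1 > √(−a1) for all t ∈ ℝ, then γ is constant. (System (III) has no small limit cycles surrounding the equilibrium (1, F(1)) when a2 ≥ (a1 − 1 − √(−a1))/3.) -/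
/-- A solution of system (III): x' = y − δ(a2 x + x³/3), y' = −x(a1 + x²)(x² − 1). -/
def IsSolIII (a1 a2 δ : ℝ) (γ : ℝ → ℝ × ℝ) : Prop :=
  ∀ t : ℝ, HasDerivAt γ
    ((γ t).2 - δ * (a2 * (γ t).1 + (γ t).1 ^ 3 / 3),
      -((γ t).1 * (a1 + (γ t).1 ^ 2) * ((γ t).1 ^ 2 - 1))) t

/-- An antitone periodic function is constant. -/
theorem Antitone.eq_of_periodic {f : ℝ → ℝ} (hf : Antitone f) {T : ℝ} (hT : 0 < T)
    (hper : Function.Periodic f T) (t s : ℝ) : f t = f s := by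
  have key : ∀ t s, f t ≤ f s := fun t s => by
    obtain ⟨n, hn⟩ := exists_nat_ge ((s - t) / T)
    rw [div_le_iff₀ hT] at hn
    rw [← hper.nat_mul n t]
    exact hf (by linarith)
  exact le_antisymm (key t s) (key s t)

theorem IsSolIII.hasDerivAt_fst {a1 a2 δ : ℝ} {γ : ℝ → ℝ × ℝ} (hsol : IsSolIII a1 a2 δ γ)
    (t : ℝ) : HasDerivAt (fun t => (γ t).1)
      ((γ t).2 - δ * (a2 * (γ t).1 + (γ t).1 ^ 3 / 3)) t :=
  (ContinuousLinearMap.fst ℝ ℝ ℝ).hasFDerivAt.comp_hasDerivAt t (hsol t)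

theorem IsSolIII.hasDerivAt_snd {a1 a2 δ : ℝ} {γ : ℝ → ℝ × ℝ} (hsol : IsSolIII a1 a2 δ γ)
    (t : ℝ) : HasDerivAt (fun t => (γ t).2)
      (-((γ t).1 * (a1 + (γ t).1 ^ 2) * ((γ t).1 ^ 2 - 1))) t :=
  (ContinuousLinearMap.snd ℝ ℝ ℝ).hasFDerivAt.comp_hasDerivAt t (hsol t)

/-- The energy `(y - F(1))² / 2 + G(x)` of the Liénard system, where `F` is the damping
and `G` is the primitive of the restoring force vanishing at `0`. -/
noncomputable def lienardEnergy (a1 a2 δ : ℝ) (p : ℝ × ℝ) : ℝ :=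
  (p.2 - δ * (a2 + 1 / 3)) ^ 2 / 2 + (p.1 ^ 6 / 6 + (a1 - 1) * p.1 ^ 4 / 4 - a1 * p.1 ^ 2 / 2)

/-- Along solutions, the energy has derivative `-g(x) (F(x) - F(1))`. -/
theorem IsSolIII.hasDerivAt_lienardEnergy {a1 a2 δ : ℝ} {γ : ℝ → ℝ × ℝ}
    (hsol : IsSolIII a1 a2 δ γ) (t : ℝ) :
    HasDerivAt (fun t => lienardEnergy a1 a2 δ (γ t))
      (-(δ * (γ t).1 * (a1 + (γ t).1 ^ 2) * ((γ t).1 + 1) * ((γ t).1 - 1) ^ 2 *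
        (a2 + (1 + (γ t).1 + (γ t).1 ^ 2) / 3))) t := by
  have hx := hsol.hasDerivAt_fst t
  have hy := hsol.hasDerivAt_snd t
  have h := (((hy.sub_const (δ * (a2 + 1 / 3))).pow 2).div_const 2).add
    ((((hx.pow 6).div_const 6).add (((hx.pow 4).const_mul (a1 - 1)).div_const 4)).sub
      (((hx.pow 2).const_mul a1).div_const 2))
  refine h.congr_deriv ?_
  push_cast
  ring

/-- In the half-plane `x > √(-a1)`, every factor of the dissipation other than `(x - 1)²`
is positive. -/
theorem dissipation_factor_pos {a1 a2 δ x : ℝ} (ha1 : a1 < 0) (hδ : 0 < δ)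
    (ha2 : (a1 - 1 - Real.sqrt (-a1)) / 3 ≤ a2) (hx : Real.sqrt (-a1) < x) :
    0 < δ * x * (a1 + x ^ 2) * (x + 1) * (a2 + (1 + x + x ^ 2) / 3) := by
  have hc := Real.sqrt_nonneg (-a1)
  have hsq := Real.sq_sqrt (neg_nonneg.mpr ha1.le)
  have hx0 : 0 < x := hc.trans_lt hx
  have h1 : 0 < a1 + x ^ 2 := by nlinarith
  have h2 : 0 < a2 + (1 + x + x ^ 2) / 3 := by linarith
  positivity

/-- for −1 < a1 < 0, δ > 0, a2 ≥ (a1 − 1 − √(−a1))/3, every periodic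
solution of system (III) lying in the half-plane x > √(−a1) is constant
(no small limit cycles around (1, F(1))). -/
theorem stmt11 (a1 a2 δ : ℝ) (ha1l : -1 < a1) (ha1r : a1 < 0) (hδ : 0 < δ)
    (ha2 : (a1 - 1 - Real.sqrt (-a1)) / 3 ≤ a2)
    (γ : ℝ → ℝ × ℝ) (hsol : IsSolIII a1 a2 δ γ)
    (T : ℝ) (hT : 0 < T) (hper : ∀ t : ℝ, γ (t + T) = γ t)
    (hzone : ∀ t : ℝ, Real.sqrt (-a1) < (γ t).1) :
    ∀ t s : ℝ, γ t = γ s := by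
  have hE := hsol.hasDerivAt_lienardEnergy
  have hpos := fun t => dissipation_factor_pos ha1r hδ ha2 (hzone t)
  have hanti : Antitone fun t => lienardEnergy a1 a2 δ (γ t) := by
    refine antitone_of_hasDerivAt_nonpos hE fun t => ?_
    have := mul_nonneg (hpos t).le (sq_nonneg ((γ t).1 - 1))
    simp only [Pi.zero_apply]
    linarith
  have hconst := hanti.eq_of_periodic hT fun t => by simp only [hper t]
  have hx : ∀ t, (γ t).1 = 1 := fun t => by
    have h0 : HasDerivAt (fun t => lienardEnergy a1 a2 δ (γ t)) 0 t :=
      (hasDerivAt_const t (lienardEnergy a1 a2 δ (γ t))).congr_of_eventuallyEq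
        (Filter.Eventually.of_forall fun s => hconst s t)
    have h := (hE t).unique h0
    have hmul : δ * (γ t).1 * (a1 + (γ t).1 ^ 2) * ((γ t).1 + 1) *
        (a2 + (1 + (γ t).1 + (γ t).1 ^ 2) / 3) * ((γ t).1 - 1) ^ 2 = 0 := by
      linarith
    have hsq := (mul_eq_zero.mp hmul).resolve_left (hpos t).ne'
    exact sub_eq_zero.mp (pow_eq_zero_iff two_ne_zero |>.mp hsq)
  have hy : ∀ t, (γ t).2 = δ * (a2 + 1 / 3) := fun t => by
    have h0 : HasDerivAt (fun t => (γ t).1) 0 t :=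
      (hasDerivAt_const t (1 : ℝ)).congr_of_eventuallyEq (Filter.Eventually.of_forall hx)
    have h := (hsol.hasDerivAt_fst t).unique h0
    simp only [hx t] at h
    linarith
  intro t s
  exact Prod.ext ((hx t).trans (hx s).symm) ((hy t).trans (hy s).symm)
end
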